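/- Let m = n. Then all envy-free allocations of the n items to the n agents have the same welfare: if A and A' are both envy-free allocations for the utility matrix x, then u(A) = u(A'). -/

import Mathlib

open Finset

/-- A utility matrix for `n` agents and `m` items: `x i j` is the (nonnegative)
utility of agent `j` for item `i`, and each agent's utilities sum to `1`. -/
def IsUtilMatrix (n m : ℕ) (x : Fin m → Fin n → ℝ) : Prop :=
  (∀ i j, 0 ≤ x i j) ∧ (∀ j, ∑ i, x i j = 1)

/-- The utility that agent `j` assigns to the bundle of items allocated to
agent `j'` by the allocation `A`. -/
def bundleUtil {n m : ℕ} (x : Fin m → Fin n → ℝ) (A : Fin m → Fin n)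
    (j j' : Fin n) : ℝ :=
  ∑ i ∈ Finset.univ.filter (fun i => A i = j'), x i j

/-- The allocation `A` is envy-free: no agent values another agent's bundle
more than its own. -/
def EnvyFree {n m : ℕ} (x : Fin m → Fin n → ℝ) (A : Fin m → Fin n) : Prop :=
  ∀ j j', bundleUtil x A j j ≥ bundleUtil x A j j'

/-- The welfare of allocation `A`: the sum of the agents' utilities for
their own bundles. -/
def welfare {n m : ℕ} (x : Fin m → Fin n → ℝ) (A : Fin m → Fin n) : ℝ :=
  ∑ j, bundleUtil x A j j

/-- Optimal welfare over all allocations. -/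
noncomputable def uStar (n m : ℕ) (x : Fin m → Fin n → ℝ) : ℝ :=
  sSup {w : ℝ | ∃ A : Fin m → Fin n, w = welfare x A}

/-- Optimal welfare over all envy-free allocations. -/
noncomputable def uStarF (n m : ℕ) (x : Fin m → Fin n → ℝ) : ℝ :=
  sSup {w : ℝ | ∃ A : Fin m → Fin n, EnvyFree x A ∧ w = welfare x A}

/-- The price of envy-freeness for `n` agents and `m` items: the supremum of
`uStar x / uStarF x` over all utility matrices admitting an envy-free
allocation. -/
noncomputable def pEnvy (n m : ℕ) : ℝ :=
  sSup {r : ℝ | ∃ x : Fin m → Fin n → ℝ, IsUtilMatrix n m x ∧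
    (∃ A : Fin m → Fin n, EnvyFree x A) ∧ r = uStar n m x / uStarF n m x}

theorem sum_bundleUtil {n m : ℕ} (x : Fin m → Fin n → ℝ) (A : Fin m → Fin n) (j : Fin n) :
    ∑ j', bundleUtil x A j j' = ∑ i, x i j :=
  Finset.sum_fiberwise univ A fun i => x i j

theorem bundleUtil_apply_of_injective {n m : ℕ} (x : Fin m → Fin n → ℝ) {A : Fin m → Fin n}
    (hA : Function.Injective A) (j : Fin n) (i : Fin m) :
    bundleUtil x A j (A i) = x i j := by
  simp [bundleUtil, hA.eq_iff, Finset.filter_eq']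

/-- In an envy-free allocation every agent receives an item. -/
theorem EnvyFree.surjective {n m : ℕ} {x : Fin m → Fin n → ℝ} (hx : IsUtilMatrix n m x)
    {A : Fin m → Fin n} (hA : EnvyFree x A) : Function.Surjective A := by
  intro j
  by_contra! h
  have h0 : bundleUtil x A j j = 0 := by simp [bundleUtil, h]
  have hle : ∑ j', bundleUtil x A j j' ≤ 0 :=
    Finset.sum_nonpos fun j' _ => (hA j j').trans_eq h0
  rw [sum_bundleUtil, hx.2 j] at hle
  linarith

/-- With as many items as agents, an agent's own bundle in an envy-free allocation is worth
the maximal utility of a single item. -/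
theorem EnvyFree.isGreatest_bundleUtil {n : ℕ} {x : Fin n → Fin n → ℝ}
    (hx : IsUtilMatrix n n x) {A : Fin n → Fin n} (hA : EnvyFree x A) (j : Fin n) :
    IsGreatest (Set.range fun i => x i j) (bundleUtil x A j j) := by
  have hinj : Function.Injective A := Finite.injective_iff_surjective.2 (hA.surjective hx)
  constructor
  · obtain ⟨i, rfl⟩ := hA.surjective hx j
    exact ⟨i, (bundleUtil_apply_of_injective x hinj (A i) i).symm⟩
  · rintro _ ⟨i, rfl⟩
    exact (bundleUtil_apply_of_injective x hinj j i).ge.trans (hA j (A i))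

/-- For `m = n`, all envy-free allocations of the `n` items to the `n` agents
have the same welfare. -/
theorem envyFree_welfare_unique (n : ℕ) (hn : 1 ≤ n)
    (x : Fin n → Fin n → ℝ) (hx : IsUtilMatrix n n x)
    (A A' : Fin n → Fin n) (hA : EnvyFree x A) (hA' : EnvyFree x A') :
    welfare x A = welfare x A' :=
  Finset.sum_congr rfl fun j _ =>
    (hA.isGreatest_bundleUtil hx j).unique (hA'.isGreatest_bundleUtil hx j)
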